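/- Let L be a hermitian O_H-lattice of even rank m with (x,y) ∈ πO_H for all x,y ∈ L. Suppose Λ ∈ Vert(L) satisfies t(Λ) = m − 2 and dim_{𝔽_p}((π^{-1}Λ♯ ∩ L♯)/Λ) = 2, and suppose Λ admits an orthogonal splitting Λ = Λ_0 ⊕ Λ_{−1}, where Λ_0 is a split π^0-modular lattice of rank 2 (isometric to H(0)) and Λ_{−1} is π^{−1}-modular. Then there exists Λ' ∈ Vert(L) with Λ ⊆ Λ' and t(Λ') = m. -/

import Mathlib

/- Common setup: ramified quadratic extension H/ℚ_p, ring of integers O_H,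
   hermitian forms, lattices, duals, vertex lattices. -/

open scoped Classical

noncomputable section

namespace Ramified

/-- The ring of integers of `H`: the integral closure of `ℤ_p` in `H`. -/
def OH (p : ℕ) [Fact (Nat.Prime p)] (H : Type) [Field H] [Algebra ℚ_[p] H] : Subring H :=
  letI : Algebra ℤ_[p] H := ((algebraMap ℚ_[p] H).comp PadicInt.Coe.ringHom).toAlgebra
  (integralClosure ℤ_[p] H).toSubring

/-- `H/ℚ_p` is a ramified quadratic extension with nontrivial Galois automorphism `conj`
and uniformizer `ϖ` satisfying `conj ϖ = -ϖ` and `ϖ² = π₀` a uniformizer of `ℤ_p`. -/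
structure IsRamifiedQuadratic (p : ℕ) [Fact (Nat.Prime p)] (H : Type) [Field H]
    [Algebra ℚ_[p] H] (conj : H ≃+* H) (ϖ : H) : Prop where
  conj_conj : ∀ x : H, conj (conj x) = x
  conj_fix : ∀ q : ℚ_[p], conj (algebraMap ℚ_[p] H q) = algebraMap ℚ_[p] H q
  conj_ne : conj ≠ RingEquiv.refl H
  dim_two : Module.finrank ℚ_[p] H = 2
  conj_unif : conj ϖ = -ϖ
  unif_sq : ∃ u : ℤ_[p]ˣ, ϖ * ϖ = algebraMap ℚ_[p] H ((u : ℤ_[p]) : ℚ_[p]) * (p : H)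

variable {p : ℕ} [Fact (Nat.Prime p)] {H : Type} [Field H] [Algebra ℚ_[p] H]

/-- Any `H`-module is an `O_H`-module by restriction of scalars. -/
instance moduleOH (C : Type) [AddCommGroup C] [Module H C] : Module (OH p H) C :=
  Module.compHom C (OH p H).subtype

variable {C : Type} [AddCommGroup C] [Module H C]

theorem oh_smul_def (c : OH p H) (x : C) : c • x = (c : H) • x := rfl

/-- A hermitian form on `C` with respect to the conjugation `conj` of `H`:
linear in the first variable, conjugate-symmetric. -/
structure HermForm (H : Type) [Field H] (C : Type) [AddCommGroup C] [Module H C]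
    (conj : H ≃+* H) where
  form : C → C → H
  form_add : ∀ x y z : C, form (x + y) z = form x z + form y z
  form_smul : ∀ (a : H) (x y : C), form (a • x) y = a * form x y
  form_conj : ∀ x y : C, form y x = conj (form x y)

variable {conj : H ≃+* H}

theorem HermForm.form_zero (φ : HermForm H C conj) (y : C) : φ.form 0 y = 0 := by
  have h := φ.form_smul (0 : H) 0 y
  simpa using h

/-- The dual lattice `Λ♯ = {x : C | φ(x, Λ) ⊆ O_H}`. -/
def HermForm.dual (φ : HermForm H C conj) (Λ : Submodule (OH p H) C) :
    Submodule (OH p H) C where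
  carrier := {x : C | ∀ y ∈ Λ, φ.form x y ∈ OH p H}
  add_mem' := by
    intro a b ha hb y hy
    rw [φ.form_add]
    exact add_mem (ha y hy) (hb y hy)
  zero_mem' := by
    intro y hy
    rw [HermForm.form_zero]
    exact zero_mem _
  smul_mem' := by
    intro c x hx y hy
    show φ.form ((c : H) • x) y ∈ OH p H
    rw [φ.form_smul]
    exact mul_mem c.2 (hx y hy)

/-- The orthogonal complement (in `C = L ⊗ H`) of a sublattice. -/
def HermForm.orthog (φ : HermForm H C conj) (N : Submodule (OH p H) C) :
    Submodule (OH p H) C where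
  carrier := {x : C | ∀ y ∈ N, φ.form x y = 0}
  add_mem' := by
    intro a b ha hb y hy
    rw [φ.form_add, ha y hy, hb y hy, add_zero]
  zero_mem' := by
    intro y hy
    rw [HermForm.form_zero]
  smul_mem' := by
    intro c x hx y hy
    show φ.form ((c : H) • x) y = 0
    rw [φ.form_smul, hx y hy, mul_zero]

/-- Scalar multiplication by `a : H`, as an `O_H`-linear map. -/
def smulMap (a : H) : C →ₗ[OH p H] C where
  toFun x := a • x
  map_add' x y := smul_add a x y
  map_smul' c x := by
    show a • ((c : H) • x) = (c : H) • (a • x)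
    rw [smul_comm]

/-- The lattice `a • Λ` for a scalar `a : H`. -/
def scale (a : H) (Λ : Submodule (OH p H) C) : Submodule (OH p H) C :=
  Λ.map (smulMap a)

/-- An `H`-subspace of `C`, viewed as an `O_H`-submodule. -/
def restrictOH (W : Submodule H C) : Submodule (OH p H) C where
  carrier := (W : Set C)
  add_mem' := fun ha hb => W.add_mem ha hb
  zero_mem' := W.zero_mem
  smul_mem' := fun c x hx => W.smul_mem (c : H) hx

/-- The cardinality of the quotient `Λ/N` (for `N ⊆ Λ` this is the usual quotient). -/
def quotCard (N Λ : Submodule (OH p H) C) : ℕ :=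
  Nat.card (Λ ⧸ N.comap Λ.subtype)

/-- A (full) `O_H`-lattice in `C`: finitely generated and spanning `C` over `H`. -/
def IsLattice (Λ : Submodule (OH p H) C) : Prop :=
  Λ.FG ∧ Submodule.span H (Λ : Set C) = ⊤

/-- A vertex lattice: a full lattice with `ϖΛ ⊆ Λ♯ ⊆ Λ`. -/
def IsVertexLattice (φ : HermForm H C conj) (ϖ : H) (Λ : Submodule (OH p H) C) : Prop :=
  IsLattice Λ ∧ scale ϖ Λ ≤ φ.dual Λ ∧ φ.dual Λ ≤ Λ

/-- `Λ ∈ Vert(L)`: a vertex lattice with `L ⊆ Λ♯`. -/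
def InVert (φ : HermForm H C conj) (ϖ : H) (L Λ : Submodule (OH p H) C) : Prop :=
  IsVertexLattice φ ϖ Λ ∧ L ≤ φ.dual Λ

/-- `M` is `a`-modular (e.g. `a = ϖ^i`): `(x, M) = a·O_H` for every maximal `x ∈ M`. -/
def IsPiModular (φ : HermForm H C conj) (ϖ a : H) (M : Submodule (OH p H) C) : Prop :=
  ∀ x ∈ M, x ∉ scale ϖ M →
    (fun y => φ.form x y) '' (M : Set C) = (fun c => a * c) '' ((OH p H : Set H))

/-- `N` is split: an orthogonal direct sum of hyperbolic planes `H(i)`. -/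
def IsSplitLat (φ : HermForm H C conj) (ϖ : H) (N : Submodule (OH p H) C) : Prop :=
  ∃ (s : ℕ) (e f : Fin s → C) (d : Fin s → ℕ),
    N = Submodule.span (OH p H) (Set.range e ∪ Set.range f) ∧
    (∀ j, φ.form (e j) (e j) = 0 ∧ φ.form (f j) (f j) = 0 ∧
      φ.form (e j) (f j) = ϖ ^ d j) ∧
    ∀ j j', j ≠ j' → φ.form (e j) (e j') = 0 ∧ φ.form (e j) (f j') = 0 ∧
      φ.form (f j) (e j') = 0 ∧ φ.form (f j) (f j') = 0

/-- The `O_H`-rank of a sublattice of `C` (the dimension of the subspace it spans). -/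
def rk (N : Submodule (OH p H) C) : ℕ :=
  Module.finrank H (Submodule.span H (N : Set C))

/-- A Jordan splitting `L = ⊕_{0 ≤ λ ≤ k} L_λ` with `L_λ` being `ϖ^λ`-modular (or zero). -/
structure JordanSplitting (φ : HermForm H C conj) (ϖ : H) (L : Submodule (OH p H) C)
    (k : ℕ) (Lc : ℕ → Submodule (OH p H) C) : Prop where
  sup_eq : L = ⨆ i ∈ Finset.range (k + 1), Lc i
  bot_of_gt : ∀ i, k < i → Lc i = ⊥
  disj : ∀ i ∈ Finset.range (k + 1),
    Disjoint (Lc i) (⨆ j ∈ (Finset.range (k + 1)).erase i, Lc j)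
  orthog : ∀ i j, i ≠ j → ∀ x ∈ Lc i, ∀ y ∈ Lc j, φ.form x y = 0
  modular : ∀ i ∈ Finset.range (k + 1), Lc i ≠ ⊥ → IsPiModular φ ϖ (ϖ ^ i) (Lc i)

/-- `L_{≥ t} = ⊕_{λ ≥ t} L_λ`. -/
def Lge (Lc : ℕ → Submodule (OH p H) C) (k t : ℕ) : Submodule (OH p H) C :=
  ⨆ i ∈ Finset.Icc t k, Lc i

/-- `m(L) = rank_{O_H} L_{≥1}`. -/
def mOf (Lc : ℕ → Submodule (OH p H) C) (k : ℕ) : ℕ :=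
  ∑ i ∈ Finset.Icc 1 k, rk (Lc i)

/-- The invariant `t(L)` from Theorem A. -/
def tOf (φ : HermForm H C conj) (ϖ : H) (Lc : ℕ → Submodule (OH p H) C) (k : ℕ) : ℕ :=
  if Odd (mOf Lc k) then mOf Lc k - 1
  else if IsSplitLat φ ϖ (Lge Lc k 1) then mOf Lc k
  else mOf Lc k - 2

/-- `n_odd = Σ_{λ ≥ 3, λ odd} rank L_λ`. -/
def nOdd (Lc : ℕ → Submodule (OH p H) C) (k : ℕ) : ℕ :=
  ∑ i ∈ (Finset.Icc 3 k).filter (fun i => Odd i), rk (Lc i)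

/-- `n_even = Σ_{λ ≥ 2, λ even} rank L_λ`. -/
def nEven (Lc : ℕ → Submodule (OH p H) C) (k : ℕ) : ℕ :=
  ∑ i ∈ (Finset.Icc 2 k).filter (fun i => Even i), rk (Lc i)

end Ramified

namespace Ramified

section RingOfIntegers

variable {p : ℕ} [Fact (Nat.Prime p)] {H : Type} [Field H] [Algebra ℚ_[p] H]

theorem mem_OH_iff (x : H) :
    x ∈ OH p H ↔ ((algebraMap ℚ_[p] H).comp PadicInt.Coe.ringHom).IsIntegralElem x :=
  Iff.rfl

theorem algebraMap_mem_OH_iff (q : ℚ_[p]) : algebraMap ℚ_[p] H q ∈ OH p H ↔ ‖q‖ ≤ 1 := by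
  rw [mem_OH_iff]
  constructor
  · rintro ⟨f, hf, h⟩
    rw [← Polynomial.hom_eval₂, map_eq_zero] at h
    have hq : IsIntegral ℤ_[p] q := ⟨f, hf, h⟩
    obtain ⟨y, rfl⟩ := IsIntegrallyClosed.isIntegral_iff.1 hq
    exact y.2
  · intro h
    let y : ℤ_[p] := ⟨q, h⟩
    exact RingHom.isIntegralElem_map ((algebraMap ℚ_[p] H).comp PadicInt.Coe.ringHom) (x := y)

namespace IsRamifiedQuadratic

variable {conj : H ≃+* H} {ϖ : H}

theorem conj_mem (hram : IsRamifiedQuadratic p H conj ϖ) {x : H} (hx : x ∈ OH p H) :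
    conj x ∈ OH p H := by
  rw [mem_OH_iff] at hx ⊢
  obtain ⟨f, hf, h⟩ := hx
  refine ⟨f, hf, ?_⟩
  have h2 := congrArg conj h
  have hcomp : conj.toRingHom.comp ((algebraMap ℚ_[p] H).comp PadicInt.Coe.ringHom) =
      (algebraMap ℚ_[p] H).comp PadicInt.Coe.ringHom :=
    RingHom.ext fun z => hram.conj_fix z
  have h3 := Polynomial.hom_eval₂ f ((algebraMap ℚ_[p] H).comp PadicInt.Coe.ringHom)
    conj.toRingHom x
  rw [hcomp] at h3
  exact h3.symm.trans (h2.trans (map_zero conj))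

theorem exists_sq_eq (hram : IsRamifiedQuadratic p H conj ϖ) :
    ∃ q : ℚ_[p], ϖ * ϖ = algebraMap ℚ_[p] H q ∧ ‖q‖ = (p : ℝ)⁻¹ := by
  obtain ⟨u, hu⟩ := hram.unif_sq
  refine ⟨((u : ℤ_[p]) : ℚ_[p]) * p, by simp [hu], ?_⟩
  have : ‖((u : ℤ_[p]) : ℚ_[p])‖ = 1 := PadicInt.norm_units u
  simp [this]

theorem unif_ne_zero (hram : IsRamifiedQuadratic p H conj ϖ) : ϖ ≠ 0 := by
  rintro rfl
  obtain ⟨q, h, hq⟩ := hram.exists_sq_eq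
  have h0 : q = 0 := by simpa using h.symm
  have hp0 := (Fact.out : p.Prime).ne_zero
  simp [h0, eq_comm, hp0] at hq

theorem unif_mem (hram : IsRamifiedQuadratic p H conj ϖ) : ϖ ∈ OH p H := by
  obtain ⟨q, h, hq⟩ := hram.exists_sq_eq
  have hq1 : ‖q‖ ≤ 1 := by
    rw [hq]
    exact inv_le_one_of_one_le₀ (by exact_mod_cast (Fact.out : p.Prime).one_lt.le)
  have h2 := (algebraMap_mem_OH_iff (H := H) q).2 hq1
  rw [← h] at h2
  let _ : Algebra ℤ_[p] H := ((algebraMap ℚ_[p] H).comp PadicInt.Coe.ringHom).toAlgebra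
  have h3 : IsIntegral ℤ_[p] (ϖ ^ 2) := by rw [sq]; exact h2
  exact IsIntegral.of_pow two_pos h3

theorem inv_unif_notMem (hram : IsRamifiedQuadratic p H conj ϖ) : ϖ⁻¹ ∉ OH p H := by
  intro h
  obtain ⟨q, hϖ, hq⟩ := hram.exists_sq_eq
  have h2 := mul_mem h h
  rw [← mul_inv, hϖ, ← map_inv₀, algebraMap_mem_OH_iff, norm_inv, hq, inv_inv] at h2
  have : 1 < (p : ℝ) := by exact_mod_cast (Fact.out : p.Prime).one_lt
  linarith

theorem exists_eq_add_mul (hram : IsRamifiedQuadratic p H conj ϖ) (a : H) :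
    ∃ x y : ℚ_[p], a = algebraMap ℚ_[p] H x + algebraMap ℚ_[p] H y * ϖ := by
  have hchar : (2 : H) ≠ 0 := by
    have : CharZero H := charZero_of_injective_algebraMap (algebraMap ℚ_[p] H).injective
    exact two_ne_zero
  have hli : LinearIndependent ℚ_[p] ![(1 : H), ϖ] := by
    rw [LinearIndependent.pair_iff]
    intro s t h
    have h2 := congrArg conj h
    simp only [Algebra.smul_def, mul_one, map_add, map_mul, hram.conj_fix, hram.conj_unif,
      map_zero] at h h2
    have hs : algebraMap ℚ_[p] H s = 0 := by
      have : 2 * algebraMap ℚ_[p] H s = 0 := by linear_combination h + h2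
      exact (mul_eq_zero.1 this).resolve_left hchar
    rw [hs, zero_add, mul_eq_zero, or_iff_left hram.unif_ne_zero] at h
    exact ⟨by simpa using hs, by simpa using h⟩
  have hspan := hli.span_eq_top_of_card_eq_finrank (by simp [hram.dim_two])
  have ha : a ∈ Submodule.span ℚ_[p] (Set.range ![(1 : H), ϖ]) := hspan ▸ Submodule.mem_top
  simp only [Matrix.range_cons, Matrix.range_empty, Set.union_empty,
    Set.singleton_union] at ha
  obtain ⟨x, y, h⟩ := Submodule.mem_span_pair.1 ha
  exact ⟨x, y, by simp [← h, Algebra.smul_def]⟩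

theorem exists_sub_eq_unif_mul (hram : IsRamifiedQuadratic p H conj ϖ) (hp : p ≠ 2)
    {a : H} (ha : a ∈ OH p H) :
    ∃ x : ℤ_[p], ∃ c ∈ OH p H, a - algebraMap ℚ_[p] H x = ϖ * c := by
  obtain ⟨x, y, rfl⟩ := hram.exists_eq_add_mul a
  obtain ⟨q, hϖ, hq⟩ := hram.exists_sq_eq
  have hc := hram.conj_mem ha
  have hnorm := mul_mem ha hc
  have htr := add_mem ha hc
  simp only [map_add, map_mul, hram.conj_fix, hram.conj_unif] at hc hnorm htr
  have hx : ‖x‖ ≤ 1 := by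
    have h : algebraMap ℚ_[p] H (2 * x) ∈ OH p H := by
      convert htr using 1
      rw [map_mul, map_ofNat]
      ring
    rw [algebraMap_mem_OH_iff, norm_mul] at h
    have h2 : ‖(2 : ℚ_[p])‖ = 1 := by
      have := (Padic.norm_natCast_eq_one_iff (p := p) (n := 2)).2
        ((Nat.coprime_primes Fact.out Nat.prime_two).2 hp)
      exact_mod_cast this
    rwa [h2, one_mul] at h
  have hp1 : 1 < (p : ℝ) := by exact_mod_cast (Fact.out : p.Prime).one_lt
  have hy : ‖y‖ ≤ 1 := by
    have hxm := (algebraMap_mem_OH_iff (H := H) x).2 hx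
    have h : algebraMap ℚ_[p] H (y * y * q) ∈ OH p H := by
      convert sub_mem (mul_mem hxm hxm) hnorm using 1
      rw [map_mul, map_mul, ← hϖ]
      ring
    rw [algebraMap_mem_OH_iff, norm_mul, norm_mul, hq, ← div_eq_mul_inv,
      div_le_one (by linarith)] at h
    have hlt : ‖y‖ < (p : ℝ) := by nlinarith [norm_nonneg y]
    have := (Padic.norm_le_pow_iff_norm_lt_pow_add_one y 0).2 (by simpa using hlt)
    simpa using this
  exact ⟨⟨x, hx⟩, _, (algebraMap_mem_OH_iff y).2 hy, by simp [mul_comm]⟩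

/-- The uniformizer as an element of `O_H`. -/
def unif (hram : IsRamifiedQuadratic p H conj ϖ) : OH p H := ⟨ϖ, hram.unif_mem⟩

theorem unif_dvd_iff (hram : IsRamifiedQuadratic p H conj ϖ) (a : OH p H) :
    hram.unif ∣ a ↔ ϖ⁻¹ * (a : H) ∈ OH p H := by
  have h0 := hram.unif_ne_zero
  constructor
  · rintro ⟨c, rfl⟩
    have : ϖ⁻¹ * ((hram.unif * c : OH p H) : H) = c := by
      change ϖ⁻¹ * (ϖ * (c : H)) = c
      field_simp
    rw [this]
    exact c.2
  · intro h
    refine ⟨⟨_, h⟩, Subtype.ext ?_⟩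
    change (a : H) = ϖ * (ϖ⁻¹ * a)
    field_simp

theorem card_quotient_unif (hram : IsRamifiedQuadratic p H conj ϖ) (hp : p ≠ 2) :
    Nat.card (OH p H ⧸ Ideal.span {hram.unif}) = p := by
  let i : ℤ_[p] →+* OH p H :=
    ((algebraMap ℚ_[p] H).comp PadicInt.Coe.ringHom).codRestrict (OH p H)
      fun z => (algebraMap_mem_OH_iff _).2 z.2
  let f := (Ideal.Quotient.mk (Ideal.span {hram.unif})).comp i
  have hsurj : Function.Surjective f := by
    intro b
    obtain ⟨a, rfl⟩ := Ideal.Quotient.mk_surjective b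
    obtain ⟨x, c, hc, h⟩ := hram.exists_sub_eq_unif_mul hp a.2
    refine ⟨x, ((Ideal.Quotient.eq).2 (Ideal.mem_span_singleton.2 ⟨⟨c, hc⟩, ?_⟩)).symm⟩
    exact Subtype.ext h
  have hker : RingHom.ker f = IsLocalRing.maximalIdeal ℤ_[p] := by
    refine ((IsLocalRing.maximalIdeal.isMaximal ℤ_[p]).eq_of_le ?_ ?_).symm
    · intro h
      have h1 : f 1 = 0 := RingHom.mem_ker.1 (h ▸ Submodule.mem_top)
      rw [map_one, ← map_one (Ideal.Quotient.mk _), Ideal.Quotient.eq_zero_iff_mem,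
        Ideal.mem_span_singleton, hram.unif_dvd_iff] at h1
      exact hram.inv_unif_notMem (by simpa using h1)
    · rw [PadicInt.maximalIdeal_eq_span_p, Ideal.span_singleton_le_iff_mem, RingHom.mem_ker]
      obtain ⟨u, hu⟩ := hram.unif_sq
      rw [RingHom.comp_apply, Ideal.Quotient.eq_zero_iff_mem, Ideal.mem_span_singleton]
      have h1 : i u * i p = hram.unif * hram.unif := by
        refine Subtype.ext (Eq.trans ?_ hu.symm)
        change algebraMap ℚ_[p] H ((u : ℤ_[p]) : ℚ_[p]) * algebraMap ℚ_[p] H ((p : ℤ_[p]) : ℚ_[p])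
          = _
        simp
      have h2 : i p = hram.unif * (hram.unif * i ((u⁻¹ : ℤ_[p]ˣ) : ℤ_[p])) := by
        have h3 : i u * i ((u⁻¹ : ℤ_[p]ˣ) : ℤ_[p]) = 1 := by rw [← map_mul]; simp
        linear_combination (-i p) * h3 + i ((u⁻¹ : ℤ_[p]ˣ) : ℤ_[p]) * h1
      exact ⟨_, h2⟩
  have e := RingHom.quotientKerEquivOfSurjective hsurj
  rw [← Nat.card_congr e.toEquiv, hker]
  have := Nat.card_congr (PadicInt.residueField (p := p)).toEquiv
  rw [Nat.card_zmod] at this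
  exact this

end IsRamifiedQuadratic

end RingOfIntegers

section Forms

variable {p : ℕ} [Fact (Nat.Prime p)] {H : Type} [Field H] [Algebra ℚ_[p] H]
  {conj : H ≃+* H} {ϖ : H} {C : Type} [AddCommGroup C] [Module H C]

namespace HermForm

theorem form_add_right (φ : HermForm H C conj) (x y z : C) :
    φ.form x (y + z) = φ.form x y + φ.form x z := by
  rw [φ.form_conj (y + z), φ.form_add, map_add, ← φ.form_conj, ← φ.form_conj]

theorem form_smul_right (φ : HermForm H C conj) (a : H) (x y : C) :
    φ.form x (a • y) = conj a * φ.form x y := by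
  rw [φ.form_conj (a • y), φ.form_smul, map_mul, ← φ.form_conj]

theorem mem_dual_iff (φ : HermForm H C conj) {Λ : Submodule (OH p H) C} {x : C} :
    x ∈ φ.dual Λ ↔ ∀ y ∈ Λ, φ.form x y ∈ OH p H :=
  Iff.rfl

theorem dual_anti (φ : HermForm H C conj) {M N : Submodule (OH p H) C} (h : M ≤ N) :
    φ.dual N ≤ φ.dual M :=
  fun _ hx y hy => hx y (h hy)

theorem form_mem_comm (φ : HermForm H C conj) (hram : IsRamifiedQuadratic p H conj ϖ) {x y : C}
    (h : φ.form x y ∈ OH p H) : φ.form y x ∈ OH p H := by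
  rw [φ.form_conj x y]
  exact hram.conj_mem h

theorem le_dual_comm (φ : HermForm H C conj) (hram : IsRamifiedQuadratic p H conj ϖ)
    {M N : Submodule (OH p H) C} (h : M ≤ φ.dual N) : N ≤ φ.dual M :=
  fun x hx y hy => φ.form_mem_comm hram (h hy x hx)

theorem mem_dual_span_singleton (φ : HermForm H C conj) (hram : IsRamifiedQuadratic p H conj ϖ)
    {x y : C} : x ∈ φ.dual (Submodule.span (OH p H) {y}) ↔ φ.form x y ∈ OH p H := by
  constructor
  · exact fun h => h y (Submodule.mem_span_singleton_self y)
  · intro h z hz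
    obtain ⟨c, rfl⟩ := Submodule.mem_span_singleton.1 hz
    rw [oh_smul_def, form_smul_right]
    exact mul_mem (hram.conj_mem c.2) h

theorem mem_dual_sup (φ : HermForm H C conj) {M N : Submodule (OH p H) C} {x : C} :
    x ∈ φ.dual (M ⊔ N) ↔ x ∈ φ.dual M ∧ x ∈ φ.dual N := by
  constructor
  · exact fun h => ⟨φ.dual_anti le_sup_left h, φ.dual_anti le_sup_right h⟩
  · rintro ⟨h1, h2⟩ z hz
    obtain ⟨a, ha, b, hb, rfl⟩ := Submodule.mem_sup.1 hz
    rw [form_add_right]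
    exact add_mem (h1 a ha) (h2 b hb)

end HermForm

theorem mem_scale_iff {a : H} {Λ : Submodule (OH p H) C} {x : C} :
    x ∈ scale a Λ ↔ ∃ y ∈ Λ, a • y = x :=
  Submodule.mem_map

theorem quotCard_eq_relIndex (N Λ : Submodule (OH p H) C) :
    quotCard N Λ = N.toAddSubgroup.relIndex Λ.toAddSubgroup :=
  rfl

theorem quotCard_mul_quotCard {N M Λ : Submodule (OH p H) C} (h1 : N ≤ M) (h2 : M ≤ Λ) :
    quotCard N M * quotCard M Λ = quotCard N Λ := by
  simp only [quotCard_eq_relIndex]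
  exact AddSubgroup.relIndex_mul_relIndex _ _ _ h1 h2

theorem quotCard_eq_card_range {N Λ : Submodule (OH p H) C} {Q : Type*} [AddCommGroup Q]
    (f : Λ →+ Q) (hf : ∀ x : Λ, f x = 0 ↔ (x : C) ∈ N) :
    quotCard N Λ = Nat.card f.range := by
  rw [← AddSubgroup.index_ker, quotCard_eq_relIndex, AddSubgroup.relIndex]
  congr 1
  ext x
  exact (hf x).symm

/-- The reduction modulo `ϖ` of the form against a fixed vector `e`, on a lattice pairing
integrally with `e`. -/
def formMod (φ : HermForm H C conj) (hram : IsRamifiedQuadratic p H conj ϖ)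
    (Λ : Submodule (OH p H) C) (e : C) (h : ∀ x ∈ Λ, φ.form x e ∈ OH p H) :
    Λ →+ OH p H ⧸ Ideal.span {hram.unif} :=
  AddMonoidHom.mk' (fun x => Ideal.Quotient.mk _ ⟨φ.form x e, h x x.2⟩) fun x y => by
    rw [← map_add]
    exact congrArg _ (Subtype.ext (φ.form_add _ _ _))

theorem formMod_eq_zero_iff (φ : HermForm H C conj) (hram : IsRamifiedQuadratic p H conj ϖ)
    {Λ : Submodule (OH p H) C} {e : C} (h : ∀ x ∈ Λ, φ.form x e ∈ OH p H) (x : Λ) :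
    formMod φ hram Λ e h x = 0 ↔ ϖ⁻¹ * φ.form x e ∈ OH p H := by
  rw [← hram.unif_dvd_iff ⟨φ.form x e, h x x.2⟩, ← Ideal.mem_span_singleton,
    ← Ideal.Quotient.eq_zero_iff_mem]
  rfl

theorem quotCard_eq_of_form_eq_one (φ : HermForm H C conj)
    (hram : IsRamifiedQuadratic p H conj ϖ) (hp : p ≠ 2) {N Λ : Submodule (OH p H) C} {e f : C}
    (h : ∀ x ∈ Λ, φ.form x e ∈ OH p H) (hf : f ∈ Λ) (hfe : φ.form f e = 1)
    (hN : ∀ x ∈ Λ, ϖ⁻¹ * φ.form x e ∈ OH p H ↔ x ∈ N) :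
    quotCard N Λ = p := by
  rw [quotCard_eq_card_range (formMod φ hram Λ e h)
    fun x => (formMod_eq_zero_iff φ hram h x).trans (hN x x.2)]
  have hsurj : Function.Surjective (formMod φ hram Λ e h) := by
    intro b
    obtain ⟨a, rfl⟩ := Ideal.Quotient.mk_surjective b
    refine ⟨a • ⟨f, hf⟩, congrArg (Ideal.Quotient.mk (Ideal.span {hram.unif})) (Subtype.ext ?_)⟩
    change φ.form ((a : H) • f) e = a
    rw [φ.form_smul, hfe, mul_one]
  rw [AddMonoidHom.range_eq_top.2 hsurj, AddSubgroup.card_top, hram.card_quotient_unif hp]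

theorem unif_smul_mem_dual (φ : HermForm H C conj) (hram : IsRamifiedQuadratic p H conj ϖ)
    {Λ : Submodule (OH p H) C} {x : C} (hx : x ∈ scale ϖ⁻¹ (φ.dual Λ)) :
    ϖ • x ∈ φ.dual Λ := by
  obtain ⟨y, hy, rfl⟩ := mem_scale_iff.1 hx
  rwa [smul_inv_smul₀ hram.unif_ne_zero]

end Forms

/-- `L` of even rank `m`, form valued in `ϖ·O_H`; `Λ ∈ Vert(L)` with
`t(Λ) = m - 2`, `dim_{𝔽_p}((ϖ⁻¹Λ♯ ∩ L♯)/Λ) = 2`, and `Λ = Λ₀ ⊕ Λ₋₁` orthogonally, where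
`Λ₀` is split `ϖ^0`-modular of rank 2 (isometric to `H(0)`) and `Λ₋₁` is `ϖ⁻¹`-modular.
Then there exists `Λ' ∈ Vert(L)` with `Λ ⊆ Λ'` and `t(Λ') = m`. -/
theorem statement_6 (p : ℕ) [Fact (Nat.Prime p)] (hp : p ≠ 2)
    (H : Type) [Field H] [Algebra ℚ_[p] H] (conj : H ≃+* H) (ϖ : H)
    (hram : IsRamifiedQuadratic p H conj ϖ)
    (C : Type) [AddCommGroup C] [Module H C]
    (φ : HermForm H C conj)
    (hnd : ∀ x : C, (∀ y : C, φ.form x y = 0) → x = 0)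
    (L Λ Λ0 Λm1 : Submodule (OH p H) C) (m : ℕ)
    (hm : Even m)
    (hL : IsLattice L)
    (hrank : Module.finrank H C = m)
    (hLπ : ∀ x ∈ L, ∀ y ∈ L, ∃ a ∈ OH p H, φ.form x y = ϖ * a)
    (hΛ : InVert φ ϖ L Λ)
    (ht : quotCard (φ.dual Λ) Λ = p ^ (m - 2))
    (hr : quotCard Λ (scale ϖ⁻¹ (φ.dual Λ) ⊓ φ.dual L) = p ^ 2)
    -- the orthogonal splitting `Λ = Λ₀ ⊕ Λ₋₁`
    (hsplit : Λ = Λ0 ⊔ Λm1)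
    (hdisj : Disjoint Λ0 Λm1)
    (horth : ∀ x ∈ Λ0, ∀ y ∈ Λm1, φ.form x y = 0)
    -- `Λ₀` is isometric to the hyperbolic plane `H(0)`
    (hΛ0 : ∃ e1 e2 : C, Λ0 = Submodule.span (OH p H) ({e1, e2} : Set C) ∧
      φ.form e1 e1 = 0 ∧ φ.form e2 e2 = 0 ∧ φ.form e1 e2 = 1)
    -- `Λ₋₁` is `ϖ⁻¹`-modular
    (hΛm1 : IsPiModular φ ϖ ϖ⁻¹ Λm1) :
    ∃ Λ' : Submodule (OH p H) C, InVert φ ϖ L Λ' ∧ Λ ≤ Λ' ∧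
      quotCard (φ.dual Λ') Λ' = p ^ m := by
  obtain ⟨e1, e2, rfl, h11, h22, h12⟩ := hΛ0
  obtain ⟨⟨⟨hfg, hspan⟩, hϖΛ, hdual⟩, hLΛ⟩ := hΛ
  have h0 := hram.unif_ne_zero
  have h21 : φ.form e2 e1 = 1 := by rw [φ.form_conj, h12, map_one]
  have he1Λ : e1 ∈ Λ := hsplit ▸ Submodule.mem_sup_left (Submodule.subset_span (by simp))
  have hm1Λ : Λm1 ≤ Λ := hsplit ▸ le_sup_right
  -- decomposition of vectors of `Λ`
  have hdec : ∀ x ∈ Λ, ∃ a b : OH p H, ∃ z ∈ Λm1, x = (a : H) • e1 + (b : H) • e2 + z := by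
    intro x hx
    rw [hsplit] at hx
    obtain ⟨y, hy, z, hz, rfl⟩ := Submodule.mem_sup.1 hx
    obtain ⟨a, b, rfl⟩ := Submodule.mem_span_pair.1 hy
    exact ⟨a, b, z, hz, rfl⟩
  have horth1 : ∀ z ∈ Λm1, φ.form z e1 = 0 := fun z hz => by
    rw [φ.form_conj, horth _ (Submodule.subset_span (by simp)) z hz, map_zero]
  have horth2 : ∀ z ∈ Λm1, φ.form z e2 = 0 := fun z hz => by
    rw [φ.form_conj, horth _ (Submodule.subset_span (by simp)) z hz, map_zero]
  have hform1 : ∀ x ∈ Λ, φ.form x e1 ∈ OH p H := by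
    intro x hx
    obtain ⟨a, b, z, hz, rfl⟩ := hdec x hx
    simp [φ.form_add, φ.form_smul, h11, h21, horth1 z hz]
  have hform2 : ∀ x ∈ Λ, φ.form x e2 ∈ OH p H := by
    intro x hx
    obtain ⟨a, b, z, hz, rfl⟩ := hdec x hx
    simp [φ.form_add, φ.form_smul, h22, h12, horth2 z hz]
  have he1 : e1 ∈ φ.dual Λ := fun y hy => φ.form_mem_comm hram (hform1 y hy)
  have he2 : e2 ∈ φ.dual Λ := fun y hy => φ.form_mem_comm hram (hform2 y hy)
  -- vectors of `ϖ⁻¹ Λ♯` pairing integrally with `e1` and `e2` lie in `Λ`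
  have hkey : ∀ x, ϖ • x ∈ φ.dual Λ → φ.form x e1 ∈ OH p H → φ.form x e2 ∈ OH p H → x ∈ Λ := by
    intro x hx hx1 hx2
    obtain ⟨a, b, z, hz, hxe⟩ := hdec _ (hdual hx)
    have hz' : z ∈ scale ϖ Λm1 := by
      by_contra hz'
      have h1 : ϖ⁻¹ ∈ (fun c => ϖ⁻¹ * c) '' ((OH p H : Set H)) := ⟨1, one_mem _, mul_one _⟩
      rw [← hΛm1 z hz hz'] at h1
      obtain ⟨w, hw, hzw⟩ := h1
      have h2 := hx w (hm1Λ hw)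
      rw [hxe, φ.form_add, φ.form_add, φ.form_smul, φ.form_smul,
        horth e1 (Submodule.subset_span (by simp)) w hw,
        horth e2 (Submodule.subset_span (by simp)) w hw] at h2
      simp only [mul_zero, zero_add] at h2
      exact hram.inv_unif_notMem (hzw ▸ h2)
    obtain ⟨w, hw, rfl⟩ := mem_scale_iff.1 hz'
    have hb := congrArg (fun v => φ.form v e1) hxe
    have ha := congrArg (fun v => φ.form v e2) hxe
    simp only [φ.form_add, φ.form_smul, h11, h12, h21, h22, horth1 w hw, horth2 w hw, mul_zero,
      mul_one, zero_add, add_zero] at ha hb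
    have hxe' : x = φ.form x e2 • e1 + φ.form x e1 • e2 + w := by
      apply smul_right_injective C h0
      simp only [smul_add, smul_smul, ha, hb, hxe]
    rw [hxe', hsplit]
    refine add_mem (Submodule.mem_sup_left (Submodule.mem_span_pair.2
      ⟨⟨_, hx2⟩, ⟨_, hx1⟩, rfl⟩)) (Submodule.mem_sup_right hw)
  -- the vector adjoined to `Λ`
  set f := ϖ⁻¹ • e1 with hf
  have hϖf : ϖ • f = e1 := smul_inv_smul₀ h0 _
  have hformf : ∀ x, φ.form x f = -(ϖ⁻¹ * φ.form x e1) := fun x => by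
    rw [hf, φ.form_smul_right, map_inv₀, hram.conj_unif, inv_neg, neg_mul]
  have hΛL : Λ ≤ φ.dual L := φ.le_dual_comm hram hLΛ
  have hfL : f ∈ φ.dual L := by
    set M := scale ϖ⁻¹ (φ.dual Λ) ⊓ φ.dual L with hM
    have hMd : ∀ x : M, ϖ • (x : C) ∈ φ.dual Λ := fun x => unif_smul_mem_dual φ hram x.2.1
    let g : M →+ φ.dual Λ := AddMonoidHom.mk' (fun x => ⟨ϖ • (x : C), hMd x⟩)
      fun x y => Subtype.ext (smul_add _ _ _)
    let r1 := formMod φ hram (φ.dual Λ) e1 fun x hx => hform1 x (hdual hx)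
    let r2 := formMod φ hram (φ.dual Λ) e2 fun x hx => hform2 x (hdual hx)
    let r := (r1.comp g).prod (r2.comp g)
    have hr0 : ∀ x : M, r x = 0 ↔ (x : C) ∈ Λ := by
      intro x
      have hrx : r x = 0 ↔ φ.form x e1 ∈ OH p H ∧ φ.form x e2 ∈ OH p H := by
        change (r1 (g x), r2 (g x)) = 0 ↔ _
        rw [Prod.mk_eq_zero, formMod_eq_zero_iff, formMod_eq_zero_iff]
        change ϖ⁻¹ * φ.form (ϖ • (x : C)) e1 ∈ _ ∧ ϖ⁻¹ * φ.form (ϖ • (x : C)) e2 ∈ _ ↔ _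
        rw [φ.form_smul, φ.form_smul, inv_mul_cancel_left₀ h0, inv_mul_cancel_left₀ h0]
      rw [hrx]
      exact ⟨fun h => hkey x (hMd x) h.1 h.2, fun h => ⟨hform1 x h, hform2 x h⟩⟩
    have hcard := hram.card_quotient_unif hp
    have : Finite (OH p H ⧸ Ideal.span {hram.unif}) :=
      Nat.finite_of_card_ne_zero (hcard.trans_ne (Fact.out : p.Prime).ne_zero)
    rw [quotCard_eq_card_range r hr0] at hr
    have htop : r.range = ⊤ := by
      apply AddSubgroup.eq_top_of_card_eq
      rw [hr, Nat.card_prod, hcard, sq]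
    obtain ⟨x, hx⟩ := AddMonoidHom.range_eq_top.1 htop (r1 ⟨e1, he1⟩, r2 ⟨e1, he1⟩)
    have hx1 : r1 (g x - ⟨e1, he1⟩) = 0 := by
      rw [map_sub, sub_eq_zero]; exact congrArg Prod.fst hx
    have hx2 : r2 (g x - ⟨e1, he1⟩) = 0 := by
      rw [map_sub, sub_eq_zero]; exact congrArg Prod.snd hx
    rw [formMod_eq_zero_iff] at hx1 hx2
    have hsub : ((g x - ⟨e1, he1⟩ : φ.dual Λ) : C) = ϖ • ((x : C) - f) := by
      rw [smul_sub, hϖf]; rfl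
    rw [hsub, φ.form_smul, inv_mul_cancel_left₀ h0] at hx1 hx2
    have hmem := hkey _ (hsub ▸ (g x - ⟨e1, he1⟩ : φ.dual Λ).2) hx1 hx2
    have := sub_mem x.2.2 (hΛL hmem)
    rwa [sub_sub_cancel] at this
  have hm2 : 2 ≤ m := by
    have : m ≠ 0 := by
      rintro rfl
      have hfin : Module.Finite H C := by
        obtain ⟨s, hs⟩ := hfg
        refine ⟨s, ?_⟩
        rw [eq_top_iff, ← hspan, Submodule.span_le, ← hs]
        intro x hx
        induction hx using Submodule.span_induction with
        | mem x hx => exact Submodule.subset_span hx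
        | zero => exact zero_mem _
        | add x y _ _ hx hy => exact add_mem hx hy
        | smul a x _ hx => exact Submodule.smul_mem _ (a : H) hx
      have := Module.finrank_zero_iff.1 hrank
      rw [Subsingleton.elim e1 0, φ.form_zero] at h12
      exact zero_ne_one h12
    obtain ⟨k, rfl⟩ := hm
    omega
  have hmemdual : ∀ x, x ∈ φ.dual (Λ ⊔ Submodule.span (OH p H) {f}) ↔
      x ∈ φ.dual Λ ∧ φ.form x f ∈ OH p H := fun x => by
    rw [φ.mem_dual_sup, φ.mem_dual_span_singleton hram]
  set Λ' := Λ ⊔ Submodule.span (OH p H) {f} with hΛ'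
  have hle : Λ ≤ Λ' := le_sup_left
  have hfΛ' : f ∈ Λ' := Submodule.mem_sup_right (Submodule.mem_span_singleton_self f)
  have hd : φ.dual Λ' ≤ φ.dual Λ := φ.dual_anti hle
  refine ⟨Λ', ⟨⟨⟨hfg.sup (Submodule.fg_span_singleton f), ?_⟩, ?_, hd.trans (hdual.trans hle)⟩,
    ?_⟩, hle, ?_⟩
  · rw [eq_top_iff, ← hspan]
    exact Submodule.span_mono hle
  · intro y hy
    obtain ⟨x, hx, rfl⟩ := mem_scale_iff.1 hy
    obtain ⟨v, hv, w, hw, rfl⟩ := Submodule.mem_sup.1 hx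
    obtain ⟨c, rfl⟩ := Submodule.mem_span_singleton.1 hw
    have h1 : ϖ • v ∈ φ.dual Λ' := by
      refine (hmemdual _).2 ⟨hϖΛ (mem_scale_iff.2 ⟨v, hv, rfl⟩), ?_⟩
      rw [hformf, φ.form_smul, inv_mul_cancel_left₀ h0]
      exact neg_mem (hform1 v hv)
    have h2 : e1 ∈ φ.dual Λ' := by
      refine (hmemdual _).2 ⟨he1, ?_⟩
      rw [hformf, h11, mul_zero, neg_zero]
      exact zero_mem _
    have h3 : ϖ • (v + c • f) = ϖ • v + c • e1 := by
      rw [smul_add, oh_smul_def, oh_smul_def, smul_comm, hϖf]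
    rw [h3]
    exact add_mem h1 (Submodule.smul_mem _ c h2)
  · intro l hl
    exact (hmemdual l).2 ⟨hLΛ hl, φ.form_mem_comm hram (hfL l hl)⟩
  · have hc1 : quotCard (φ.dual Λ') (φ.dual Λ) = p := by
      refine quotCard_eq_of_form_eq_one φ hram hp (fun x hx => hform1 x (hdual hx)) he2 h21 ?_
      intro x hx
      rw [hmemdual, hformf, neg_mem_iff]
      exact (and_iff_right hx).symm
    have hc2 : quotCard Λ Λ' = p := by
      have hpair : ∀ x ∈ Λ', ∃ v ∈ Λ, ∃ c : OH p H, x = v + (c : H) • f := by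
        intro x hx
        obtain ⟨v, hv, w, hw, rfl⟩ := Submodule.mem_sup.1 hx
        obtain ⟨c, rfl⟩ := Submodule.mem_span_singleton.1 hw
        exact ⟨v, hv, c, rfl⟩
      have hform' : ∀ x, φ.form x (-ϖ • e2) = ϖ * φ.form x e2 := fun x => by
        rw [φ.form_smul_right, map_neg, hram.conj_unif, neg_neg]
      refine quotCard_eq_of_form_eq_one φ hram hp (e := -ϖ • e2) (f := f) ?_ hfΛ' ?_ ?_
      · intro x hx
        obtain ⟨v, hv, c, rfl⟩ := hpair x hx
        rw [hform', φ.form_add, φ.form_smul, hf, φ.form_smul, h12, mul_add]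
        refine add_mem (mul_mem hram.unif_mem (hform2 v hv)) ?_
        rw [mul_one, mul_left_comm, mul_inv_cancel₀ h0, mul_one]
        exact c.2
      · rw [hform', hf, φ.form_smul, h12, mul_one, mul_inv_cancel₀ h0]
      · intro x hx
        rw [hform', inv_mul_cancel_left₀ h0]
        refine ⟨fun h => ?_, hform2 x⟩
        obtain ⟨v, hv, c, rfl⟩ := hpair x hx
        refine add_mem hv ?_
        rw [φ.form_add, add_mem_cancel_left (hform2 v hv), φ.form_smul, hf, φ.form_smul, h12,
          mul_one] at h
        rw [hf, smul_smul]
        exact Λ.smul_mem ⟨_, h⟩ he1Λ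
    rw [← quotCard_mul_quotCard hd (hdual.trans hle), ← quotCard_mul_quotCard hdual hle, hc1, hc2,
      ht, ← pow_succ, ← pow_succ']
    congr 1
    omega

end Ramified
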